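/- arXiv:1310.8323 — 2 statements merged into one kernel-verified Lean document; each statement's English description precedes it below -/
import Mathlib

section
/- Let (H, μ, Δ, α_H) be a Hom-bialgebra with α_H bijective, and let (M, α_M) and (N, α_N) be Yetter-Drinfeld modules over H with α_M, α_N bijective. Define c_{M,N}: M⊗N → N⊗M by c_{M,N}(m⊗n) = α_N^{-1}(α_H^{-1}(m_{(-1)})·n) ⊗ α_M^{-1}(m_{(0)}). Then (α_N⊗α_M)∘c_{M,N} = c_{M,N}∘(α_M⊗α_N), c_{M,N} is H-linear as a map M⊗̂N → N⊗̂M (c_{M,N}(h·(m⊗n)) = h·c_{M,N}(m⊗n)) and H-colinear ((id_H⊗c_{M,N})∘λ_{M⊗̂N} = λ_{N⊗̂M}∘c_{M,N}). -/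
open TensorProduct

noncomputable section

namespace HomYD

variable (k : Type*) [Field k]
variable {H M N : Type*}
variable [AddCommGroup H] [Module k H]
variable [AddCommGroup M] [Module k M]
variable [AddCommGroup N] [Module k N]

/-- Rearrangement `(a ⊗ b) ⊗ c ↦ (a ⊗ c) ⊗ b`. -/
def rearr (A B C : Type*) [AddCommGroup A] [Module k A] [AddCommGroup B] [Module k B]
    [AddCommGroup C] [Module k C] :
    (A ⊗[k] B) ⊗[k] C →ₗ[k] (A ⊗[k] C) ⊗[k] B :=
  (TensorProduct.assoc k A C B).symm.toLinearMap ∘ₗ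
    (TensorProduct.map LinearMap.id (TensorProduct.comm k B C).toLinearMap) ∘ₗ
      (TensorProduct.assoc k A B C).toLinearMap

/-- Middle-four exchange `(a ⊗ b) ⊗ (c ⊗ d) ↦ (a ⊗ c) ⊗ (b ⊗ d)`. -/
def ttc (A B C D : Type*) [AddCommGroup A] [Module k A] [AddCommGroup B] [Module k B]
    [AddCommGroup C] [Module k C] [AddCommGroup D] [Module k D] :
    (A ⊗[k] B) ⊗[k] (C ⊗[k] D) →ₗ[k] (A ⊗[k] C) ⊗[k] (B ⊗[k] D) :=
  (TensorProduct.tensorTensorTensorComm k A B C D).toLinearMap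

/-- Hom-bialgebra (no unit/counit): multiplicativity of `α`, Hom-associativity,
comultiplicativity of `α`, Hom-coassociativity, and `Δ` multiplicative. -/
structure IsHomBialgebra (μ : H ⊗[k] H →ₗ[k] H) (Δ : H →ₗ[k] H ⊗[k] H)
    (α : H →ₗ[k] H) : Prop where
  mul_mult : ∀ a b : H, α (μ (a ⊗ₜ[k] b)) = μ (α a ⊗ₜ[k] α b)
  hom_assoc : ∀ a b c : H, μ (α a ⊗ₜ[k] μ (b ⊗ₜ[k] c)) = μ (μ (a ⊗ₜ[k] b) ⊗ₜ[k] α c)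
  comul_compat : TensorProduct.map α α ∘ₗ Δ = Δ ∘ₗ α
  hom_coassoc : (TensorProduct.assoc k H H H).toLinearMap ∘ₗ TensorProduct.map Δ α ∘ₗ Δ
      = TensorProduct.map α Δ ∘ₗ Δ
  comul_mul : Δ ∘ₗ μ
      = TensorProduct.map μ μ ∘ₗ ttc k H H H H ∘ₗ TensorProduct.map Δ Δ

/-- Left module over a Hom-(bi)algebra. -/
structure IsHomModule (μ : H ⊗[k] H →ₗ[k] H) (α : H →ₗ[k] H)
    (ρ : H ⊗[k] M →ₗ[k] M) (αM : M →ₗ[k] M) : Prop where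
  str_compat : ∀ (h : H) (m : M), αM (ρ (h ⊗ₜ[k] m)) = ρ (α h ⊗ₜ[k] αM m)
  hom_smul : ∀ (h h' : H) (m : M),
      ρ (α h ⊗ₜ[k] ρ (h' ⊗ₜ[k] m)) = ρ (μ (h ⊗ₜ[k] h') ⊗ₜ[k] αM m)

/-- Left comodule over a Hom-(bi)algebra. -/
structure IsHomComodule (Δ : H →ₗ[k] H ⊗[k] H) (α : H →ₗ[k] H)
    (lM : M →ₗ[k] H ⊗[k] M) (αM : M →ₗ[k] M) : Prop where
  str_compat : TensorProduct.map α αM ∘ₗ lM = lM ∘ₗ αM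
  hom_coact : TensorProduct.map Δ αM ∘ₗ lM
      = (TensorProduct.assoc k H H M).symm.toLinearMap ∘ₗ TensorProduct.map α lM ∘ₗ lM

/-- `h ⊗ m ↦ (h₁·m)₍₋₁₎ β(h₂) ⊗ (h₁·m)₍₀₎`. -/
def ydL (μ : H ⊗[k] H →ₗ[k] H) (Δ : H →ₗ[k] H ⊗[k] H) (β : H →ₗ[k] H)
    (ρ : H ⊗[k] M →ₗ[k] M) (lM : M →ₗ[k] H ⊗[k] M) : H ⊗[k] M →ₗ[k] H ⊗[k] M :=
  TensorProduct.map μ LinearMap.id ∘ₗ rearr k H M H ∘ₗ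
    TensorProduct.map (lM ∘ₗ ρ) β ∘ₗ rearr k H H M ∘ₗ
      TensorProduct.map Δ LinearMap.id

/-- `h ⊗ m ↦ β(h₁) γ(m₍₋₁₎) ⊗ γ(h₂)·m₍₀₎`. -/
def ydR (μ : H ⊗[k] H →ₗ[k] H) (Δ : H →ₗ[k] H ⊗[k] H) (β γ : H →ₗ[k] H)
    (ρ : H ⊗[k] M →ₗ[k] M) (lM : M →ₗ[k] H ⊗[k] M) : H ⊗[k] M →ₗ[k] H ⊗[k] M :=
  TensorProduct.map (μ ∘ₗ TensorProduct.map β γ) (ρ ∘ₗ TensorProduct.map γ LinearMap.id) ∘ₗ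
    ttc k H H H M ∘ₗ TensorProduct.map Δ lM

/-- Yetter-Drinfeld module over a Hom-bialgebra: Hom-module, Hom-comodule and the
compatibility `(h₁·m)₍₋₁₎ α²(h₂) ⊗ (h₁·m)₍₀₎ = α²(h₁) α(m₍₋₁₎) ⊗ α(h₂)·m₍₀₎`. -/
def IsYetterDrinfeld (μ : H ⊗[k] H →ₗ[k] H) (Δ : H →ₗ[k] H ⊗[k] H) (α : H →ₗ[k] H)
    (ρ : H ⊗[k] M →ₗ[k] M) (lM : M →ₗ[k] H ⊗[k] M) (αM : M →ₗ[k] M) : Prop :=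
  IsHomModule k μ α ρ αM ∧ IsHomComodule k Δ α lM αM ∧
    ydL k μ Δ (α ∘ₗ α) ρ lM = ydR k μ Δ (α ∘ₗ α) α ρ lM

/-- `m ⊗ n ↦ αHinv(m₍₋₁₎)·n ⊗ m₍₀₎`. -/
def Bmap (αHinv : H →ₗ[k] H) (lM : M →ₗ[k] H ⊗[k] M) (ρN : H ⊗[k] N →ₗ[k] N) :
    M ⊗[k] N →ₗ[k] N ⊗[k] M :=
  TensorProduct.map (ρN ∘ₗ TensorProduct.map αHinv LinearMap.id) LinearMap.id ∘ₗ
    rearr k H M N ∘ₗ TensorProduct.map lM LinearMap.id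

/-- Quasi-braiding `m ⊗ n ↦ αN⁻¹(αH⁻¹(m₍₋₁₎)·n) ⊗ αM⁻¹(m₍₀₎)`. -/
def braidYD (αH : H ≃ₗ[k] H) (αM : M ≃ₗ[k] M) (αN : N ≃ₗ[k] N)
    (lM : M →ₗ[k] H ⊗[k] M) (ρN : H ⊗[k] N →ₗ[k] N) : M ⊗[k] N →ₗ[k] N ⊗[k] M :=
  TensorProduct.map
      (αN.symm.toLinearMap ∘ₗ ρN ∘ₗ TensorProduct.map αH.symm.toLinearMap LinearMap.id)
      αM.symm.toLinearMap ∘ₗ rearr k H M N ∘ₗ TensorProduct.map lM LinearMap.id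

/-- Action on `M ⊗ N`: `h ⊗ (m ⊗ n) ↦ h₁·m ⊗ h₂·n`. -/
def hatAction (Δ : H →ₗ[k] H ⊗[k] H)
    (ρM : H ⊗[k] M →ₗ[k] M) (ρN : H ⊗[k] N →ₗ[k] N) :
    H ⊗[k] (M ⊗[k] N) →ₗ[k] M ⊗[k] N :=
  TensorProduct.map ρM ρN ∘ₗ ttc k H H M N ∘ₗ TensorProduct.map Δ LinearMap.id

/-- Coaction on `M ⊗ N`: `m ⊗ n ↦ αHinv²(m₍₋₁₎ n₍₋₁₎) ⊗ (m₍₀₎ ⊗ n₍₀₎)`. -/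
def hatCoaction (μ : H ⊗[k] H →ₗ[k] H) (αHinv : H →ₗ[k] H)
    (lM : M →ₗ[k] H ⊗[k] M) (lN : N →ₗ[k] H ⊗[k] N) :
    M ⊗[k] N →ₗ[k] H ⊗[k] (M ⊗[k] N) :=
  TensorProduct.map (αHinv ∘ₗ αHinv ∘ₗ μ) LinearMap.id ∘ₗ ttc k H M H N ∘ₗ
    TensorProduct.map lM lN

/-- Action on `M ⊗ N`: `h ⊗ (m ⊗ n) ↦ αHinv²(h₁)·m ⊗ αHinv²(h₂)·n`. -/
def tildeAction (Δ : H →ₗ[k] H ⊗[k] H) (αHinv : H →ₗ[k] H)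
    (ρM : H ⊗[k] M →ₗ[k] M) (ρN : H ⊗[k] N →ₗ[k] N) :
    H ⊗[k] (M ⊗[k] N) →ₗ[k] M ⊗[k] N :=
  TensorProduct.map ρM ρN ∘ₗ ttc k H H M N ∘ₗ
    TensorProduct.map
      (TensorProduct.map (αHinv ∘ₗ αHinv) (αHinv ∘ₗ αHinv) ∘ₗ Δ) LinearMap.id

/-- Coaction on `M ⊗ N`: `m ⊗ n ↦ m₍₋₁₎ n₍₋₁₎ ⊗ (m₍₀₎ ⊗ n₍₀₎)`. -/
def tildeCoaction (μ : H ⊗[k] H →ₗ[k] H)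
    (lM : M →ₗ[k] H ⊗[k] M) (lN : N →ₗ[k] H ⊗[k] N) :
    M ⊗[k] N →ₗ[k] H ⊗[k] (M ⊗[k] N) :=
  TensorProduct.map μ LinearMap.id ∘ₗ ttc k H M H N ∘ₗ TensorProduct.map lM lN

/-- Associator `(x ⊗ y) ⊗ z ↦ αX⁻¹(x) ⊗ (y ⊗ αZ(z))`. -/
def aYD {X Z : Type*} [AddCommGroup X] [Module k X] [AddCommGroup Z] [Module k Z]
    (αX : X ≃ₗ[k] X) (Y : Type*) [AddCommGroup Y] [Module k Y] (αZ : Z ≃ₗ[k] Z) :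
    (X ⊗[k] Y) ⊗[k] Z →ₗ[k] X ⊗[k] (Y ⊗[k] Z) :=
  (TensorProduct.assoc k X Y Z).toLinearMap ∘ₗ
    TensorProduct.map (TensorProduct.map αX.symm.toLinearMap LinearMap.id) αZ.toLinearMap

/-- Inverse associator `x ⊗ (y ⊗ z) ↦ (αX(x) ⊗ y) ⊗ αZ⁻¹(z)`. -/
def aYDinv {X Z : Type*} [AddCommGroup X] [Module k X] [AddCommGroup Z] [Module k Z]
    (αX : X ≃ₗ[k] X) (Y : Type*) [AddCommGroup Y] [Module k Y] (αZ : Z ≃ₗ[k] Z) :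
    X ⊗[k] (Y ⊗[k] Z) →ₗ[k] (X ⊗[k] Y) ⊗[k] Z :=
  TensorProduct.map (TensorProduct.map αX.toLinearMap LinearMap.id) αZ.symm.toLinearMap ∘ₗ
    (TensorProduct.assoc k X Y Z).symm.toLinearMap

/-- Associator `(x ⊗ y) ⊗ z ↦ αX(x) ⊗ (y ⊗ αZ⁻¹(z))`. -/
def aTilde {X Z : Type*} [AddCommGroup X] [Module k X] [AddCommGroup Z] [Module k Z]
    (αX : X ≃ₗ[k] X) (Y : Type*) [AddCommGroup Y] [Module k Y] (αZ : Z ≃ₗ[k] Z) :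
    (X ⊗[k] Y) ⊗[k] Z →ₗ[k] X ⊗[k] (Y ⊗[k] Z) :=
  (TensorProduct.assoc k X Y Z).toLinearMap ∘ₗ
    TensorProduct.map (TensorProduct.map αX.toLinearMap LinearMap.id) αZ.symm.toLinearMap

/-- Inverse associator `x ⊗ (y ⊗ z) ↦ (αX⁻¹(x) ⊗ y) ⊗ αZ(z)`. -/
def aTildeInv {X Z : Type*} [AddCommGroup X] [Module k X] [AddCommGroup Z] [Module k Z]
    (αX : X ≃ₗ[k] X) (Y : Type*) [AddCommGroup Y] [Module k Y] (αZ : Z ≃ₗ[k] Z) :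
    X ⊗[k] (Y ⊗[k] Z) →ₗ[k] (X ⊗[k] Y) ⊗[k] Z :=
  TensorProduct.map (TensorProduct.map αX.symm.toLinearMap LinearMap.id) αZ.toLinearMap ∘ₗ
    (TensorProduct.assoc k X Y Z).symm.toLinearMap

/-- Quasitriangular Hom-bialgebra. -/
def IsQuasitriangular (μ : H ⊗[k] H →ₗ[k] H) (Δ : H →ₗ[k] H ⊗[k] H) (α : H →ₗ[k] H)
    (R : H ⊗[k] H) : Prop :=
  IsHomBialgebra k μ Δ α ∧
  TensorProduct.map Δ α R
    = TensorProduct.map (TensorProduct.map α α) μ (ttc k H H H H (R ⊗ₜ[k] R)) ∧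
  TensorProduct.map α Δ R
    = TensorProduct.map μ (TensorProduct.map α α ∘ₗ (TensorProduct.comm k H H).toLinearMap)
        (ttc k H H H H (R ⊗ₜ[k] R)) ∧
  ∀ h : H, TensorProduct.map μ μ (ttc k H H H H ((TensorProduct.comm k H H (Δ h)) ⊗ₜ[k] R))
      = TensorProduct.map μ μ (ttc k H H H H (R ⊗ₜ[k] Δ h))

/-- Coaction induced by an R-matrix: `m ↦ α(R²) ⊗ R¹·m`. -/
def coactionFromR (R : H ⊗[k] H) (α : H →ₗ[k] H) (ρM : H ⊗[k] M →ₗ[k] M) :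
    M →ₗ[k] H ⊗[k] M :=
  (TensorProduct.comm k M H).toLinearMap ∘ₗ TensorProduct.map ρM α ∘ₗ rearr k H H M ∘ₗ
    TensorProduct.mk k (H ⊗[k] H) M R

/-- Quasi-braiding from an R-matrix: `m ⊗ n ↦ αN⁻¹(R²·n) ⊗ αM⁻¹(R¹·m)`. -/
def braidR (R : H ⊗[k] H) (ρM : H ⊗[k] M →ₗ[k] M) (ρN : H ⊗[k] N →ₗ[k] N)
    (αM : M ≃ₗ[k] M) (αN : N ≃ₗ[k] N) : M ⊗[k] N →ₗ[k] N ⊗[k] M :=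
  TensorProduct.map αN.symm.toLinearMap αM.symm.toLinearMap ∘ₗ
    (TensorProduct.comm k M N).toLinearMap ∘ₗ TensorProduct.map ρM ρN ∘ₗ
      ttc k H H M N ∘ₗ TensorProduct.mk k (H ⊗[k] H) (M ⊗[k] N) R

/-- Coquasitriangular Hom-bialgebra. -/
def IsCoquasitriangular (μ : H ⊗[k] H →ₗ[k] H) (Δ : H →ₗ[k] H ⊗[k] H) (α : H →ₗ[k] H)
    (σ : H ⊗[k] H →ₗ[k] k) : Prop :=
  IsHomBialgebra k μ Δ α ∧
  (∀ x y z : H, σ (μ (x ⊗ₜ[k] y) ⊗ₜ[k] α z)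
      = LinearMap.mul' k k
          (TensorProduct.map σ σ (ttc k H H H H ((α x ⊗ₜ[k] α y) ⊗ₜ[k] Δ z)))) ∧
  (∀ x y z : H, σ (α x ⊗ₜ[k] μ (y ⊗ₜ[k] z))
      = LinearMap.mul' k k
          (TensorProduct.map σ σ (ttc k H H H H (Δ x ⊗ₜ[k] (α z ⊗ₜ[k] α y))))) ∧
  (∀ x y : H,
      (TensorProduct.rid k H)
        (TensorProduct.map (μ ∘ₗ (TensorProduct.comm k H H).toLinearMap) σ
          (ttc k H H H H (Δ x ⊗ₜ[k] Δ y)))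
      = (TensorProduct.lid k H)
          (TensorProduct.map σ μ (ttc k H H H H (Δ x ⊗ₜ[k] Δ y))))

/-- Action induced by a coquasitriangular form: `h ⊗ m ↦ σ(m₍₋₁₎ ⊗ α(h)) • m₍₀₎`. -/
def actionFromSigma (σ : H ⊗[k] H →ₗ[k] k) (α : H →ₗ[k] H)
    (lM : M →ₗ[k] H ⊗[k] M) : H ⊗[k] M →ₗ[k] M :=
  (TensorProduct.lid k M).toLinearMap ∘ₗ
    TensorProduct.map (σ ∘ₗ TensorProduct.map LinearMap.id α ∘ₗ
        (TensorProduct.comm k H H).toLinearMap) LinearMap.id ∘ₗ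
      (TensorProduct.assoc k H H M).symm.toLinearMap ∘ₗ
        TensorProduct.map LinearMap.id lM

/-- Quasi-braiding from a coquasitriangular form:
`m ⊗ n ↦ σ(n₍₋₁₎ ⊗ m₍₋₁₎) • (αN⁻¹(n₍₀₎) ⊗ αM⁻¹(m₍₀₎))`. -/
def braidSigma (σ : H ⊗[k] H →ₗ[k] k)
    (lM : M →ₗ[k] H ⊗[k] M) (lN : N →ₗ[k] H ⊗[k] N)
    (αM : M ≃ₗ[k] M) (αN : N ≃ₗ[k] N) : M ⊗[k] N →ₗ[k] N ⊗[k] M :=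
  (TensorProduct.lid k (N ⊗[k] M)).toLinearMap ∘ₗ
    TensorProduct.map (σ ∘ₗ (TensorProduct.comm k H H).toLinearMap)
      (TensorProduct.map αN.symm.toLinearMap αM.symm.toLinearMap ∘ₗ
        (TensorProduct.comm k M N).toLinearMap) ∘ₗ
      ttc k H M H N ∘ₗ TensorProduct.map lM lN


@[simp]
lemma rearr_tmul {A B C : Type*} [AddCommGroup A] [Module k A] [AddCommGroup B] [Module k B]
    [AddCommGroup C] [Module k C] (a : A) (b : B) (c : C) :
    rearr k A B C ((a ⊗ₜ[k] b) ⊗ₜ[k] c) = (a ⊗ₜ[k] c) ⊗ₜ[k] b := rfl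

@[simp]
lemma ttc_tmul {A B C D : Type*} [AddCommGroup A] [Module k A] [AddCommGroup B] [Module k B]
    [AddCommGroup C] [Module k C] [AddCommGroup D] [Module k D] (a : A) (b : B) (c : C) (d : D) :
    ttc k A B C D ((a ⊗ₜ[k] b) ⊗ₜ[k] (c ⊗ₜ[k] d)) = (a ⊗ₜ[k] c) ⊗ₜ[k] (b ⊗ₜ[k] d) := rfl

section Aux

variable {k}
variable {μ : H ⊗[k] H →ₗ[k] H} {Δ : H →ₗ[k] H ⊗[k] H} {αH : H ≃ₗ[k] H}
variable {ρM : H ⊗[k] M →ₗ[k] M} {lM : M →ₗ[k] H ⊗[k] M} {αM : M ≃ₗ[k] M}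
variable {ρN : H ⊗[k] N →ₗ[k] N} {lN : N →ₗ[k] H ⊗[k] N} {αN : N ≃ₗ[k] N}

lemma IsHomBialgebra.symm_mul (hH : IsHomBialgebra k μ Δ αH.toLinearMap) (x y : H) :
    αH.symm (μ (x ⊗ₜ[k] y)) = μ (αH.symm x ⊗ₜ[k] αH.symm y) := by
  have h := hH.mul_mult (αH.symm x) (αH.symm y)
  simp only [LinearEquiv.coe_coe, LinearEquiv.apply_symm_apply] at h
  rw [← h, LinearEquiv.symm_apply_apply]

lemma IsHomBialgebra.comul_symm (hH : IsHomBialgebra k μ Δ αH.toLinearMap) (h : H) :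
    Δ (αH.symm h) = TensorProduct.map αH.symm.toLinearMap αH.symm.toLinearMap (Δ h) := by
  have e := LinearMap.congr_fun hH.comul_compat (αH.symm h)
  simp only [LinearMap.comp_apply, LinearEquiv.coe_coe, LinearEquiv.apply_symm_apply] at e
  rw [← e]
  generalize Δ (αH.symm h) = t
  induction t with
  | zero => simp
  | tmul x y => simp
  | add x y hx hy => simp only [map_add, ← hx, ← hy]

lemma IsHomModule.symm_smul (hN : IsHomModule k μ αH.toLinearMap ρN αN.toLinearMap)
    (h : H) (n : N) :
    αN.symm (ρN (h ⊗ₜ[k] n)) = ρN (αH.symm h ⊗ₜ[k] αN.symm n) := by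
  have e := hN.str_compat (αH.symm h) (αN.symm n)
  simp only [LinearEquiv.coe_coe, LinearEquiv.apply_symm_apply] at e
  rw [← e, LinearEquiv.symm_apply_apply]

lemma IsHomModule.smul_smul (hN : IsHomModule k μ αH.toLinearMap ρN αN.toLinearMap)
    (h h' : H) (n : N) :
    ρN (h ⊗ₜ[k] ρN (h' ⊗ₜ[k] n)) = ρN (μ (αH.symm h ⊗ₜ[k] h') ⊗ₜ[k] αN n) := by
  simpa using hN.hom_smul (αH.symm h) h' n

lemma IsHomComodule.coact_symm (hN : IsHomComodule k Δ αH.toLinearMap lN αN.toLinearMap)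
    (n : N) :
    lN (αN.symm n) = TensorProduct.map αH.symm.toLinearMap αN.symm.toLinearMap (lN n) := by
  have e := LinearMap.congr_fun hN.str_compat (αN.symm n)
  simp only [LinearMap.comp_apply, LinearEquiv.coe_coe, LinearEquiv.apply_symm_apply] at e
  rw [← e]
  generalize lN (αN.symm n) = t
  induction t with
  | zero => simp
  | tmul x y => simp
  | add x y hx hy => simp only [map_add, ← hx, ← hy]

lemma braidYD_tmul (m : M) (n : N) :
    braidYD k αH αM αN lM ρN (m ⊗ₜ[k] n) =
      TensorProduct.map
        (αN.symm.toLinearMap ∘ₗ ρN ∘ₗ TensorProduct.map αH.symm.toLinearMap LinearMap.id)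
        αM.symm.toLinearMap (rearr k H M N (lM m ⊗ₜ[k] n)) := rfl

lemma hatCoaction_tmul (β : H →ₗ[k] H) (m : M) (n : N) :
    hatCoaction k μ β lM lN (m ⊗ₜ[k] n) =
      TensorProduct.map (β ∘ₗ β ∘ₗ μ) LinearMap.id (ttc k H M H N (lM m ⊗ₜ[k] lN n)) := rfl

/-- The left side of the Yetter-Drinfeld condition at `m`, as a map of `t = h₁ ⊗ h₂`. -/
def ydLAt (μ : H ⊗[k] H →ₗ[k] H) (β : H →ₗ[k] H) (ρ : H ⊗[k] M →ₗ[k] M)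
    (lM : M →ₗ[k] H ⊗[k] M) (m : M) : H ⊗[k] H →ₗ[k] H ⊗[k] M :=
  TensorProduct.map μ LinearMap.id ∘ₗ rearr k H M H ∘ₗ
    TensorProduct.map (lM ∘ₗ ρ) β ∘ₗ rearr k H H M ∘ₗ
      (TensorProduct.mk k (H ⊗[k] H) M).flip m

/-- The right side of the Yetter-Drinfeld condition for `u = m₍₋₁₎ ⊗ m₍₀₎`, as a map of
`t = h₁ ⊗ h₂`. -/
def ydRAt (μ : H ⊗[k] H →ₗ[k] H) (β γ : H →ₗ[k] H) (ρ : H ⊗[k] M →ₗ[k] M)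
    (u : H ⊗[k] M) : H ⊗[k] H →ₗ[k] H ⊗[k] M :=
  TensorProduct.map (μ ∘ₗ TensorProduct.map β γ) (ρ ∘ₗ TensorProduct.map γ LinearMap.id) ∘ₗ
    ttc k H H H M ∘ₗ (TensorProduct.mk k (H ⊗[k] H) (H ⊗[k] M)).flip u

lemma ydLAt_tmul (β : H →ₗ[k] H) (m : M) (x y : H) :
    ydLAt μ β ρM lM m (x ⊗ₜ[k] y) =
      TensorProduct.map μ LinearMap.id (rearr k H M H (lM (ρM (x ⊗ₜ[k] m)) ⊗ₜ[k] β y)) := rfl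

lemma ydRAt_apply (β γ : H →ₗ[k] H) (u : H ⊗[k] M) (t : H ⊗[k] H) :
    ydRAt μ β γ ρM u t =
      TensorProduct.map (μ ∘ₗ TensorProduct.map β γ)
        (ρM ∘ₗ TensorProduct.map γ LinearMap.id) (ttc k H H H M (t ⊗ₜ[k] u)) := rfl

lemma IsYetterDrinfeld.ydLAt_comul (hM : IsYetterDrinfeld k μ Δ αH.toLinearMap ρM lM αM.toLinearMap)
    (h : H) (m : M) :
    ydLAt μ (αH.toLinearMap ∘ₗ αH.toLinearMap) ρM lM m (Δ h) =
      ydRAt μ (αH.toLinearMap ∘ₗ αH.toLinearMap) αH.toLinearMap ρM (lM m) (Δ h) :=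
  LinearMap.congr_fun hM.2.2 (h ⊗ₜ[k] m)

lemma braidYD_comp_map (hM : IsHomComodule k Δ αH.toLinearMap lM αM.toLinearMap)
    (hN : IsHomModule k μ αH.toLinearMap ρN αN.toLinearMap) :
    TensorProduct.map αN.toLinearMap αM.toLinearMap ∘ₗ braidYD k αH αM αN lM ρN
      = braidYD k αH αM αN lM ρN ∘ₗ TensorProduct.map αM.toLinearMap αN.toLinearMap := by
  refine TensorProduct.ext' fun m n => ?_
  have e := LinearMap.congr_fun hM.str_compat m
  simp only [LinearMap.comp_apply, LinearEquiv.coe_coe] at e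
  simp only [LinearMap.comp_apply, TensorProduct.map_tmul, LinearEquiv.coe_coe, braidYD_tmul, ← e]
  generalize lM m = u
  induction u with
  | zero => simp
  | tmul x p =>
    have h := hN.str_compat (αH.symm (αH.symm x)) (αN.symm n)
    simp only [LinearEquiv.coe_coe, LinearEquiv.apply_symm_apply] at h
    simp [hN.symm_smul, h]
  | add x y hx hy => simp only [map_add, TensorProduct.add_tmul, hx, hy]

lemma braidYD_smul_smul (hH : IsHomBialgebra k μ Δ αH.toLinearMap)
    (hN : IsHomModule k μ αH.toLinearMap ρN αN.toLinearMap) (m : M) (n : N) (t : H ⊗[k] H) :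
    braidYD k αH αM αN lM ρN
        (TensorProduct.map ρM ρN (ttc k H H M N (t ⊗ₜ[k] (m ⊗ₜ[k] n)))) =
      TensorProduct.map
        (ρN ∘ₗ (TensorProduct.mk k H N).flip n ∘ₗ αH.symm.toLinearMap ∘ₗ αH.symm.toLinearMap ∘ₗ
          αH.symm.toLinearMap) αM.symm.toLinearMap
        (ydLAt μ (αH.toLinearMap ∘ₗ αH.toLinearMap) ρM lM m t) := by
  induction t with
  | zero => simp
  | add x y hx hy => simp only [map_add, TensorProduct.add_tmul, hx, hy]
  | tmul x y =>
    simp only [ttc_tmul, TensorProduct.map_tmul, braidYD_tmul, ydLAt_tmul]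
    generalize lM (ρM (x ⊗ₜ[k] m)) = u
    induction u with
    | zero => simp
    | add x y hx hy => simp only [map_add, TensorProduct.add_tmul, hx, hy]
    | tmul z p => simp [hN.symm_smul, hN.smul_smul, hH.symm_mul]

lemma hatAction_map_braidYD (hH : IsHomBialgebra k μ Δ αH.toLinearMap)
    (hM : IsHomModule k μ αH.toLinearMap ρM αM.toLinearMap)
    (hN : IsHomModule k μ αH.toLinearMap ρN αN.toLinearMap) (m : M) (n : N) (t : H ⊗[k] H) :
    TensorProduct.map ρN ρM
        (ttc k H H N M (t ⊗ₜ[k] braidYD k αH αM αN lM ρN (m ⊗ₜ[k] n))) =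
      TensorProduct.map
        (ρN ∘ₗ (TensorProduct.mk k H N).flip n ∘ₗ αH.symm.toLinearMap ∘ₗ αH.symm.toLinearMap ∘ₗ
          αH.symm.toLinearMap) αM.symm.toLinearMap
        (ydRAt μ (αH.toLinearMap ∘ₗ αH.toLinearMap) αH.toLinearMap ρM (lM m) t) := by
  rw [braidYD_tmul, ydRAt_apply]
  generalize lM m = u
  induction t with
  | zero => simp
  | add x y hx hy => simp only [map_add, TensorProduct.add_tmul, hx, hy]
  | tmul x y =>
    induction u with
    | zero => simp
    | add x y hx hy => simp only [map_add, TensorProduct.add_tmul, TensorProduct.tmul_add, hx, hy]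
    | tmul z p => simp [hM.symm_smul, hN.symm_smul, hN.smul_smul, hH.symm_mul]

lemma braidYD_comp_hatAction (hH : IsHomBialgebra k μ Δ αH.toLinearMap)
    (hM : IsYetterDrinfeld k μ Δ αH.toLinearMap ρM lM αM.toLinearMap)
    (hN : IsHomModule k μ αH.toLinearMap ρN αN.toLinearMap) :
    braidYD k αH αM αN lM ρN ∘ₗ hatAction k Δ ρM ρN
      = hatAction k Δ ρN ρM ∘ₗ
          TensorProduct.map (LinearMap.id : H →ₗ[k] H) (braidYD k αH αM αN lM ρN) := by
  refine TensorProduct.ext' fun h w => ?_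
  induction w with
  | zero => simp
  | add x y hx hy => simp only [map_add, TensorProduct.tmul_add, hx, hy]
  | tmul m n =>
    simp only [hatAction, LinearMap.comp_apply, TensorProduct.map_tmul, LinearMap.id_apply]
    rw [braidYD_smul_smul hH hN, hM.ydLAt_comul, hatAction_map_braidYD hH hM.1 hN]

/-- `(x ⊗ y) ⊗ p ↦ (αH⁻³ ⊗ αN⁻¹)(Φ (αH⁻² x ⊗ αH⁻² y)) ⊗ αM⁻¹ p`, reassociated. -/
def twistAssoc (αH : H ≃ₗ[k] H) (αM : M ≃ₗ[k] M) (αN : N ≃ₗ[k] N)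
    (Φ : H ⊗[k] H →ₗ[k] H ⊗[k] N) : (H ⊗[k] H) ⊗[k] M →ₗ[k] H ⊗[k] (N ⊗[k] M) :=
  (TensorProduct.assoc k H N M).toLinearMap ∘ₗ
    TensorProduct.map
      (TensorProduct.map (αH.symm.toLinearMap ∘ₗ αH.symm.toLinearMap ∘ₗ αH.symm.toLinearMap)
          αN.symm.toLinearMap ∘ₗ Φ ∘ₗ
        TensorProduct.map (αH.symm.toLinearMap ∘ₗ αH.symm.toLinearMap)
          (αH.symm.toLinearMap ∘ₗ αH.symm.toLinearMap))
      αM.symm.toLinearMap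

lemma twistAssoc_tmul (Φ : H ⊗[k] H →ₗ[k] H ⊗[k] N) (t : H ⊗[k] H) (p : M) :
    twistAssoc αH αM αN Φ (t ⊗ₜ[k] p) =
      TensorProduct.assoc k H N M
        (TensorProduct.map (αH.symm.toLinearMap ∘ₗ αH.symm.toLinearMap ∘ₗ αH.symm.toLinearMap)
          αN.symm.toLinearMap
          (Φ (TensorProduct.map (αH.symm.toLinearMap ∘ₗ αH.symm.toLinearMap)
            (αH.symm.toLinearMap ∘ₗ αH.symm.toLinearMap) t)) ⊗ₜ[k] αM.symm p) := rfl

lemma twistAssoc_ydLAt_eq_ydRAt (hH : IsHomBialgebra k μ Δ αH.toLinearMap)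
    (hN : IsYetterDrinfeld k μ Δ αH.toLinearMap ρN lN αN.toLinearMap)
    (n : N) (u : H ⊗[k] M) :
    twistAssoc αH αM αN (ydLAt μ (αH.toLinearMap ∘ₗ αH.toLinearMap) ρN lN n)
        (TensorProduct.map Δ αM.toLinearMap u) =
      twistAssoc αH αM αN
        (ydRAt μ (αH.toLinearMap ∘ₗ αH.toLinearMap) αH.toLinearMap ρN (lN n))
        (TensorProduct.map Δ αM.toLinearMap u) := by
  induction u with
  | zero => simp
  | add x y hx hy => simp only [map_add, hx, hy]
  | tmul w p =>
    have e : TensorProduct.map (αH.symm.toLinearMap ∘ₗ αH.symm.toLinearMap)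
        (αH.symm.toLinearMap ∘ₗ αH.symm.toLinearMap) (Δ w) = Δ (αH.symm (αH.symm w)) := by
      rw [hH.comul_symm, hH.comul_symm, TensorProduct.map_comp, LinearMap.comp_apply]
    simp only [TensorProduct.map_tmul, twistAssoc_tmul, e, hN.ydLAt_comul]

lemma map_braidYD_hatCoaction (hH : IsHomBialgebra k μ Δ αH.toLinearMap)
    (v : H ⊗[k] N) (u : H ⊗[k] M) :
    TensorProduct.map (LinearMap.id : H →ₗ[k] H) (braidYD k αH αM αN lM ρN)
        (TensorProduct.map (αH.symm.toLinearMap ∘ₗ αH.symm.toLinearMap ∘ₗ μ) LinearMap.id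
          (ttc k H M H N (u ⊗ₜ[k] v))) =
      twistAssoc αH αM αN
        (ydRAt μ (αH.toLinearMap ∘ₗ αH.toLinearMap) αH.toLinearMap ρN v)
        ((TensorProduct.assoc k H H M).symm (TensorProduct.map αH.toLinearMap lM u)) := by
  induction u with
  | zero => simp
  | add x y hx hy => simp only [map_add, TensorProduct.add_tmul, hx, hy]
  | tmul x p =>
    induction v with
    | zero => simp [ydRAt, twistAssoc]
    | add v w hv hw =>
      rw [TensorProduct.tmul_add, map_add, map_add, map_add, hv, hw]
      simp only [TensorProduct.map_tmul]
      generalize lM p = s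
      induction s with
      | zero => simp
      | add s t hs ht =>
        simp only [map_add, TensorProduct.tmul_add, ← hs, ← ht]
        abel
      | tmul z r =>
        simp only [TensorProduct.assoc_symm_tmul, twistAssoc_tmul, ydRAt_apply, map_add,
          TensorProduct.add_tmul, TensorProduct.tmul_add]
    | tmul y q =>
      simp only [ttc_tmul, TensorProduct.map_tmul, LinearMap.id_apply, braidYD_tmul]
      generalize lM p = s
      induction s with
      | zero => simp
      | add s t hs ht =>
        simp only [map_add, TensorProduct.add_tmul, TensorProduct.tmul_add, hs, ht]
      | tmul z r => simp [twistAssoc_tmul, ydRAt_apply, hH.symm_mul]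

lemma hatCoaction_braidYD (hH : IsHomBialgebra k μ Δ αH.toLinearMap)
    (hM : IsHomComodule k Δ αH.toLinearMap lM αM.toLinearMap)
    (hN : IsHomComodule k Δ αH.toLinearMap lN αN.toLinearMap) (n : N) (u : H ⊗[k] M) :
    hatCoaction k μ αH.symm.toLinearMap lN lM
        (TensorProduct.map
          (αN.symm.toLinearMap ∘ₗ ρN ∘ₗ TensorProduct.map αH.symm.toLinearMap LinearMap.id)
          αM.symm.toLinearMap (rearr k H M N (u ⊗ₜ[k] n))) =
      twistAssoc αH αM αN (ydLAt μ (αH.toLinearMap ∘ₗ αH.toLinearMap) ρN lN n)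
        ((TensorProduct.assoc k H H M).symm (TensorProduct.map αH.toLinearMap lM u)) := by
  induction u with
  | zero => simp
  | add x y hx hy => simp only [map_add, TensorProduct.add_tmul, hx, hy]
  | tmul x p =>
    simp only [rearr_tmul, TensorProduct.map_tmul, LinearMap.comp_apply, LinearEquiv.coe_coe,
      LinearMap.id_apply, hatCoaction_tmul, hM.coact_symm, hN.coact_symm]
    generalize lM p = s
    induction s with
    | zero => simp
    | add s t hs ht =>
      simp only [map_add, TensorProduct.tmul_add, hs, ht]
    | tmul z r =>
      simp only [TensorProduct.assoc_symm_tmul, twistAssoc_tmul, TensorProduct.map_tmul, ydLAt_tmul,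
        LinearMap.comp_apply, LinearEquiv.coe_coe, LinearEquiv.symm_apply_apply,
        LinearEquiv.apply_symm_apply]
      generalize lN (ρN (αH.symm x ⊗ₜ[k] n)) = v
      induction v with
      | zero => simp
      | add v w hv hw => simp only [map_add, TensorProduct.add_tmul, hv, hw]
      | tmul y q => simp [hH.symm_mul]

lemma map_braidYD_comp_hatCoaction (hH : IsHomBialgebra k μ Δ αH.toLinearMap)
    (hM : IsHomComodule k Δ αH.toLinearMap lM αM.toLinearMap)
    (hN : IsYetterDrinfeld k μ Δ αH.toLinearMap ρN lN αN.toLinearMap) :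
    TensorProduct.map (LinearMap.id : H →ₗ[k] H) (braidYD k αH αM αN lM ρN) ∘ₗ
        hatCoaction k μ αH.symm.toLinearMap lM lN
      = hatCoaction k μ αH.symm.toLinearMap lN lM ∘ₗ braidYD k αH αM αN lM ρN := by
  refine TensorProduct.ext' fun m n => ?_
  have e := LinearMap.congr_fun hM.hom_coact m
  simp only [LinearMap.comp_apply, LinearEquiv.coe_coe] at e
  rw [LinearMap.comp_apply, LinearMap.comp_apply, hatCoaction_tmul, map_braidYD_hatCoaction hH,
    braidYD_tmul, hatCoaction_braidYD hH hM hN.2.1, ← e, twistAssoc_ydLAt_eq_ydRAt hH hN]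

end Aux

/-- the quasi-braiding `c_{M,N}(m⊗n) = αN⁻¹(αH⁻¹(m₍₋₁₎)·n) ⊗ αM⁻¹(m₍₀₎)`
commutes with the structure maps and is a morphism of left H-modules and left
H-comodules `M ⊗̂ N → N ⊗̂ M`. -/
theorem stmt5 {k H M N : Type*} [Field k]
    [AddCommGroup H] [Module k H] [AddCommGroup M] [Module k M] [AddCommGroup N] [Module k N]
    (μ : H ⊗[k] H →ₗ[k] H) (Δ : H →ₗ[k] H ⊗[k] H) (αH : H ≃ₗ[k] H)
    (hH : IsHomBialgebra k μ Δ αH.toLinearMap)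
    (ρM : H ⊗[k] M →ₗ[k] M) (lM : M →ₗ[k] H ⊗[k] M) (αM : M ≃ₗ[k] M)
    (hM : IsYetterDrinfeld k μ Δ αH.toLinearMap ρM lM αM.toLinearMap)
    (ρN : H ⊗[k] N →ₗ[k] N) (lN : N →ₗ[k] H ⊗[k] N) (αN : N ≃ₗ[k] N)
    (hN : IsYetterDrinfeld k μ Δ αH.toLinearMap ρN lN αN.toLinearMap) :
    (TensorProduct.map αN.toLinearMap αM.toLinearMap ∘ₗ braidYD k αH αM αN lM ρN
      = braidYD k αH αM αN lM ρN ∘ₗ TensorProduct.map αM.toLinearMap αN.toLinearMap) ∧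
    (braidYD k αH αM αN lM ρN ∘ₗ hatAction k Δ ρM ρN
      = hatAction k Δ ρN ρM ∘ₗ
          TensorProduct.map (LinearMap.id : H →ₗ[k] H) (braidYD k αH αM αN lM ρN)) ∧
    (TensorProduct.map (LinearMap.id : H →ₗ[k] H) (braidYD k αH αM αN lM ρN) ∘ₗ
        hatCoaction k μ αH.symm.toLinearMap lM lN
      = hatCoaction k μ αH.symm.toLinearMap lN lM ∘ₗ braidYD k αH αM αN lM ρN) := by
  exact ⟨braidYD_comp_map hM.2.1 hN.1, braidYD_comp_hatAction hH hM hN.1,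
    map_braidYD_comp_hatCoaction hH hM.2.1 hN⟩

end HomYD
end
end

section
/- Let (H, μ, Δ, α_H) be a Hom-bialgebra with α_H bijective, and let (M, α_M), (N, α_N), (P, α_P) be Yetter-Drinfeld modules over H with bijective structure maps. With associators a_{X,Y,Z}((x⊗y)⊗z) = α_X^{-1}(x)⊗(y⊗α_Z(z)) and quasi-braidings c_{X,Y}(x⊗y) = α_Y^{-1}(α_H^{-1}(x_{(-1)})·y)⊗α_X^{-1}(x_{(0)}) (where for the map c_{M,N⊗̂P} the coaction of M and the action of N⊗̂P are used, and similarly for c_{M⊗̂N,P}), the two hexagon relations hold: a_{N,P,M} ∘ c_{M,N⊗̂P} ∘ a_{M,N,P} = (id_N⊗c_{M,P}) ∘ a_{N,M,P} ∘ (c_{M,N}⊗id_P) as maps (M⊗̂N)⊗̂P → N⊗̂(P⊗̂M), and a_{P,M,N}^{-1} ∘ c_{M⊗̂N,P} ∘ a_{M,N,P}^{-1} = (c_{M,P}⊗id_N) ∘ a_{M,P,N}^{-1} ∘ (id_M⊗c_{N,P}) as maps M⊗̂(N⊗̂P) → (P⊗̂M)⊗̂N. -/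
open TensorProduct

noncomputable section

namespace HomYD

variable (k : Type*) [Field k]
variable {H M N : Type*}
variable [AddCommGroup H] [Module k H]
variable [AddCommGroup M] [Module k M]
variable [AddCommGroup N] [Module k N]

/-- A linear map intertwining `e` with `f ⊗ g` intertwines the inverses. -/
theorem apply_symm_of_intertwines {k A B C : Type*} [Field k]
    [AddCommGroup A] [Module k A] [AddCommGroup B] [Module k B] [AddCommGroup C] [Module k C]
    (e : A ≃ₗ[k] A) (f : B ≃ₗ[k] B) (g : C ≃ₗ[k] C) (l : A →ₗ[k] B ⊗[k] C)
    (h : TensorProduct.map f.toLinearMap g.toLinearMap ∘ₗ l = l ∘ₗ e.toLinearMap) (a : A) :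
    l (e.symm a) = TensorProduct.map f.symm.toLinearMap g.symm.toLinearMap (l a) := by
  have h1 := LinearMap.congr_fun h (e.symm a)
  simp only [LinearMap.comp_apply, LinearEquiv.coe_coe, LinearEquiv.apply_symm_apply] at h1
  rw [← h1, ← LinearMap.comp_apply, ← TensorProduct.map_comp]
  simp

/-- The inverse structure map of a Hom-module is compatible with the action. -/
theorem IsHomModule.symm_apply {k H M : Type*} [Field k]
    [AddCommGroup H] [Module k H] [AddCommGroup M] [Module k M]
    {μ : H ⊗[k] H →ₗ[k] H} {α : H ≃ₗ[k] H} {ρ : H ⊗[k] M →ₗ[k] M} {αM : M ≃ₗ[k] M}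
    (hρ : IsHomModule k μ α.toLinearMap ρ αM.toLinearMap) (h : H) (m : M) :
    αM.symm (ρ (h ⊗ₜ[k] m)) = ρ (α.symm h ⊗ₜ[k] αM.symm m) := by
  rw [LinearEquiv.symm_apply_eq]
  have := hρ.str_compat (α.symm h) (αM.symm m)
  simpa using this.symm

/-- The inverse structure map of a Hom-bialgebra is multiplicative. -/
theorem IsHomBialgebra.symm_mul_s7 {k H : Type*} [Field k] [AddCommGroup H] [Module k H]
    {μ : H ⊗[k] H →ₗ[k] H} {Δ : H →ₗ[k] H ⊗[k] H} {α : H ≃ₗ[k] H}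
    (hH : IsHomBialgebra k μ Δ α.toLinearMap) (a b : H) :
    α.symm (μ (a ⊗ₜ[k] b)) = μ (α.symm a ⊗ₜ[k] α.symm b) := by
  rw [LinearEquiv.symm_apply_eq]
  have := hH.mul_mult (α.symm a) (α.symm b)
  simpa using this.symm

/-- The hexagon relation for `c_{M, N ⊗ P}`; it rests on Hom-coassociativity of the coaction. -/
theorem hexagon_hatAction {k H M N P : Type*} [Field k]
    [AddCommGroup H] [Module k H] [AddCommGroup M] [Module k M]
    [AddCommGroup N] [Module k N] [AddCommGroup P] [Module k P]
    {μ : H ⊗[k] H →ₗ[k] H} {Δ : H →ₗ[k] H ⊗[k] H} {αH : H ≃ₗ[k] H}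
    (hH : IsHomBialgebra k μ Δ αH.toLinearMap)
    {lM : M →ₗ[k] H ⊗[k] M} {αM : M ≃ₗ[k] M}
    (hM : IsHomComodule k Δ αH.toLinearMap lM αM.toLinearMap)
    (ρN : H ⊗[k] N →ₗ[k] N) (αN : N ≃ₗ[k] N) (ρP : H ⊗[k] P →ₗ[k] P) (αP : P ≃ₗ[k] P) :
    aYD k αN P αM ∘ₗ
        braidYD k αH αM (TensorProduct.congr αN αP) lM (hatAction k Δ ρN ρP) ∘ₗ
          aYD k αM N αP
      = TensorProduct.map (LinearMap.id : N →ₗ[k] N) (braidYD k αH αM αP lM ρP) ∘ₗ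
          aYD k αN M αP ∘ₗ
            TensorProduct.map (braidYD k αH αM αN lM ρN) (LinearMap.id : P →ₗ[k] P) := by
  have hΔ := apply_symm_of_intertwines αH αH αH Δ hH.comul_compat
  have hl := apply_symm_of_intertwines αM αH αM lM hM.str_compat
  refine TensorProduct.ext_threefold fun m n p => ?_
  -- `(h ⊗ h') ⊗ x ↦ αN⁻²(αH⁻²(h)·n) ⊗ (αP⁻¹(αH⁻²(h')·αP(p)) ⊗ αM⁻²(x))`
  let F : (H ⊗[k] H) ⊗[k] M →ₗ[k] N ⊗[k] (P ⊗[k] M) :=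
    (TensorProduct.assoc k N P M).toLinearMap ∘ₗ
      TensorProduct.map
        (TensorProduct.map
          (αN.symm.toLinearMap ∘ₗ αN.symm.toLinearMap ∘ₗ ρN ∘ₗ (TensorProduct.mk k H N).flip n ∘ₗ
            αH.symm.toLinearMap ∘ₗ αH.symm.toLinearMap)
          (αP.symm.toLinearMap ∘ₗ ρP ∘ₗ (TensorProduct.mk k H P).flip (αP p) ∘ₗ
            αH.symm.toLinearMap ∘ₗ αH.symm.toLinearMap))
        (αM.symm.toLinearMap ∘ₗ αM.symm.toLinearMap)
  have key := congrArg F (LinearMap.congr_fun hM.hom_coact m)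
  refine Eq.trans ?_ (key.trans ?_)
  · simp only [aYD, braidYD, LinearMap.comp_apply, TensorProduct.map_tmul, LinearEquiv.coe_coe,
      TensorProduct.assoc_tmul, LinearMap.id_coe, id_eq, hl]
    induction lM m using TensorProduct.induction_on with
    | zero => simp
    | add x y hx hy => simp only [map_add, TensorProduct.add_tmul, hx, hy]
    | tmul h x =>
      simp only [rearr, hatAction, LinearMap.comp_apply, TensorProduct.map_tmul,
        LinearEquiv.coe_coe, TensorProduct.assoc_tmul, TensorProduct.comm_tmul,
        TensorProduct.assoc_symm_tmul, LinearMap.id_coe, id_eq, hΔ]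
      induction Δ h using TensorProduct.induction_on with
      | zero => simp
      | add x y hx hy => simp only [map_add, TensorProduct.add_tmul, hx, hy]
      | tmul a b =>
        simp [F, ttc]
  · simp only [aYD, braidYD, LinearMap.comp_apply, TensorProduct.map_tmul, LinearEquiv.coe_coe,
      LinearMap.id_coe, id_eq]
    induction lM m using TensorProduct.induction_on with
    | zero => simp
    | add x y hx hy => simp only [map_add, TensorProduct.add_tmul, hx, hy]
    | tmul h x =>
      simp only [rearr, LinearMap.comp_apply, TensorProduct.map_tmul,
        LinearEquiv.coe_coe, TensorProduct.assoc_tmul, TensorProduct.comm_tmul,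
        TensorProduct.assoc_symm_tmul, LinearMap.id_coe, id_eq, hl]
      induction lM x using TensorProduct.induction_on with
      | zero => simp
      | add x y hx hy => simp only [map_add, TensorProduct.add_tmul, TensorProduct.tmul_add, hx, hy]
      | tmul a b =>
        simp [F]

/-- The hexagon relation for `c_{M ⊗ N, P}`; it rests on Hom-associativity of the action. -/
theorem hexagon_hatCoaction {k H M N P : Type*} [Field k]
    [AddCommGroup H] [Module k H] [AddCommGroup M] [Module k M]
    [AddCommGroup N] [Module k N] [AddCommGroup P] [Module k P]
    {μ : H ⊗[k] H →ₗ[k] H} {Δ : H →ₗ[k] H ⊗[k] H} {αH : H ≃ₗ[k] H}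
    (hH : IsHomBialgebra k μ Δ αH.toLinearMap)
    {lM : M →ₗ[k] H ⊗[k] M} {αM : M ≃ₗ[k] M}
    (hM : IsHomComodule k Δ αH.toLinearMap lM αM.toLinearMap)
    (lN : N →ₗ[k] H ⊗[k] N) (αN : N ≃ₗ[k] N)
    {ρP : H ⊗[k] P →ₗ[k] P} {αP : P ≃ₗ[k] P}
    (hP : IsHomModule k μ αH.toLinearMap ρP αP.toLinearMap) :
    aYDinv k αP M αN ∘ₗ
        braidYD k αH (TensorProduct.congr αM αN) αP
          (hatCoaction k μ αH.symm.toLinearMap lM lN) ρP ∘ₗ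
          aYDinv k αM N αP
      = TensorProduct.map (braidYD k αH αM αP lM ρP) (LinearMap.id : N →ₗ[k] N) ∘ₗ
          aYDinv k αM P αN ∘ₗ
            TensorProduct.map (LinearMap.id : M →ₗ[k] M) (braidYD k αH αN αP lN ρP) := by
  have hl : ∀ m, lM (αM m) = TensorProduct.map αH.toLinearMap αM.toLinearMap (lM m) :=
    fun m => (LinearMap.congr_fun hM.str_compat m).symm
  have hα : ∀ (h : H) (p : P), αP (ρP (h ⊗ₜ[k] p)) = ρP (αH h ⊗ₜ[k] αP p) := hP.str_compat
  have hρ : ∀ (a b : H) (p : P),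
      ρP (μ (αH.symm (αH.symm a) ⊗ₜ[k] αH.symm (αH.symm (αH.symm b))) ⊗ₜ[k] αP.symm p)
        = ρP (αH.symm a ⊗ₜ[k]
            ρP (αH.symm (αH.symm (αH.symm b)) ⊗ₜ[k] αP.symm (αP.symm p))) := by
    intro a b p
    have := hP.hom_smul (αH.symm (αH.symm a)) (αH.symm (αH.symm (αH.symm b)))
      (αP.symm (αP.symm p))
    simpa using this.symm
  refine TensorProduct.ext (LinearMap.ext fun m => TensorProduct.ext' fun n p => ?_)
  simp only [LinearMap.compr₂ₛₗ_apply, TensorProduct.mk_apply,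
    aYDinv, braidYD, hatCoaction, LinearMap.comp_apply, TensorProduct.map_tmul,
    LinearEquiv.coe_coe, TensorProduct.assoc_symm_tmul, LinearMap.id_coe, id_eq, hl]
  induction lN n using TensorProduct.induction_on with
  | zero => simp
  | add x y hx hy => simp only [map_add, TensorProduct.add_tmul, TensorProduct.tmul_add, hx, hy]
  | tmul b y =>
    simp only [rearr, LinearMap.comp_apply, TensorProduct.map_tmul,
      LinearEquiv.coe_coe, TensorProduct.assoc_tmul, TensorProduct.comm_tmul,
      TensorProduct.assoc_symm_tmul, LinearMap.id_coe, id_eq, hl]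
    induction lM m using TensorProduct.induction_on with
    | zero => simp
    | add x y hx hy => simp only [map_add, TensorProduct.add_tmul, hx, hy]
    | tmul a x =>
      simp [ttc, hH.symm_mul_s7, hP.symm_apply, hα, hρ]

/-- the two hexagon relations for the quasi-braiding `c` and the
associators `a` on the category of Yetter-Drinfeld modules (with the ⊗̂ structures). -/
theorem stmt7 {k H M N P : Type*} [Field k]
    [AddCommGroup H] [Module k H] [AddCommGroup M] [Module k M]
    [AddCommGroup N] [Module k N] [AddCommGroup P] [Module k P]
    (μ : H ⊗[k] H →ₗ[k] H) (Δ : H →ₗ[k] H ⊗[k] H) (αH : H ≃ₗ[k] H)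
    (hH : IsHomBialgebra k μ Δ αH.toLinearMap)
    (ρM : H ⊗[k] M →ₗ[k] M) (lM : M →ₗ[k] H ⊗[k] M) (αM : M ≃ₗ[k] M)
    (hM : IsYetterDrinfeld k μ Δ αH.toLinearMap ρM lM αM.toLinearMap)
    (ρN : H ⊗[k] N →ₗ[k] N) (lN : N →ₗ[k] H ⊗[k] N) (αN : N ≃ₗ[k] N)
    (hN : IsYetterDrinfeld k μ Δ αH.toLinearMap ρN lN αN.toLinearMap)
    (ρP : H ⊗[k] P →ₗ[k] P) (lP : P →ₗ[k] H ⊗[k] P) (αP : P ≃ₗ[k] P)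
    (hP : IsYetterDrinfeld k μ Δ αH.toLinearMap ρP lP αP.toLinearMap) :
    (aYD k αN P αM ∘ₗ
        braidYD k αH αM (TensorProduct.congr αN αP) lM (hatAction k Δ ρN ρP) ∘ₗ
          aYD k αM N αP
      = TensorProduct.map (LinearMap.id : N →ₗ[k] N) (braidYD k αH αM αP lM ρP) ∘ₗ
          aYD k αN M αP ∘ₗ
            TensorProduct.map (braidYD k αH αM αN lM ρN) (LinearMap.id : P →ₗ[k] P)) ∧
    (aYDinv k αP M αN ∘ₗ
        braidYD k αH (TensorProduct.congr αM αN) αP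
          (hatCoaction k μ αH.symm.toLinearMap lM lN) ρP ∘ₗ
          aYDinv k αM N αP
      = TensorProduct.map (braidYD k αH αM αP lM ρP) (LinearMap.id : N →ₗ[k] N) ∘ₗ
          aYDinv k αM P αN ∘ₗ
            TensorProduct.map (LinearMap.id : M →ₗ[k] M) (braidYD k αH αN αP lN ρP)) := by
  exact ⟨hexagon_hatAction hH hM.2.1 ρN αN ρP αP, hexagon_hatCoaction hH hM.2.1 lN αN hP.1⟩

end HomYD
end
end
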